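/- arXiv:2605.05677 — 2 statements merged into one kernel-verified Lean document; each statement's English description precedes it below -/
import Mathlib

section
/- For every ⟨ω⟩-orbit S ⊆ Δ₀, the integer Σ_{α∈S} n(α) is divisible by the size of the ⟨ω⟩-orbit of α₀ in Δ₀; that is, m_S := (Σ_{α∈S} n(α)) / #{ω^t(α₀) : t ∈ ℤ} is a positive integer. -/
open scoped RealInnerProductSpace

namespace Folding

variable {E : Type*} [NormedAddCommGroup E] [InnerProductSpace ℝ E]

/-- The coroot `α^∨ = 2α/(α,α)` of a nonzero vector `α`. -/
noncomputable def coroot (α : E) : E := (2 / ⟪α, α⟫) • α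

/-- The reflection `s_α(x) = x - (α^∨, x) α`. -/
noncomputable def reflVec (α x : E) : E := x - ⟪coroot α, x⟫ • α

/-- `Φ` is a (finite, not necessarily reduced) root system in `E`. -/
def IsRootSystem (Φ : Set E) : Prop :=
  Φ.Finite ∧ (0 : E) ∉ Φ ∧ Submodule.span ℝ Φ = ⊤ ∧
    (∀ α ∈ Φ, ∀ β ∈ Φ, reflVec α β ∈ Φ) ∧
    ∀ α ∈ Φ, ∀ β ∈ Φ, ∃ n : ℤ, ⟪coroot α, β⟫ = (n : ℝ)

/-- `Φ` is reduced: no root is half of another root. -/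
def IsReducedRS (Φ : Set E) : Prop := ∀ α ∈ Φ, (2⁻¹ : ℝ) • α ∉ Φ

/-- `Φ` is irreducible: nonempty and not a disjoint union of two nonempty
mutually orthogonal subsets. -/
def IsIrreducibleRS (Φ : Set E) : Prop :=
  Φ.Nonempty ∧
    ¬∃ Φ₁ Φ₂ : Set E, Φ₁.Nonempty ∧ Φ₂.Nonempty ∧ Φ₁ ∪ Φ₂ = Φ ∧ Disjoint Φ₁ Φ₂ ∧
      ∀ u ∈ Φ₁, ∀ v ∈ Φ₂, ⟪u, v⟫ = 0

/-- `Δ` is a basis (a set of simple roots) of the root system `Φ`: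
it is a vector space basis of `E`, and every root is a linear combination of `Δ`
whose coefficients are all nonnegative integers or all nonpositive integers. -/
def IsBaseRS (Φ : Set E) (Δ : Finset E) : Prop :=
  ↑Δ ⊆ Φ ∧ LinearIndependent ℝ (fun α : {x : E // x ∈ Δ} => (α : E)) ∧
    Submodule.span ℝ (Δ : Set E) = ⊤ ∧
    ∀ β ∈ Φ, ∃ c : E → ℤ, ((∀ α, 0 ≤ c α) ∨ (∀ α, c α ≤ 0)) ∧
      β = ∑ α ∈ Δ, (c α : ℝ) • α

/-- `ω` belongs to the Weyl group of `Φ`: it is a product of reflections in roots. -/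
def InWeylGroup (Φ : Set E) (ω : E ≃ₗᵢ[ℝ] E) : Prop :=
  ∃ l : List E, (∀ α ∈ l, α ∈ Φ) ∧ ∀ x : E, ω x = l.foldr reflVec x

/-- The average `x^ω = (1/o(ω)) Σ_{t=1}^{o(ω)} ω^t(x)`, where `o(ω)` is the order of `ω`. -/
noncomputable def avg (ω : E ≃ₗᵢ[ℝ] E) (x : E) : E :=
  (orderOf ω : ℝ)⁻¹ • ∑ t ∈ Finset.range (orderOf ω), (ω ^ (t + 1)) x

/-- The fixed-point set `E^ω`. -/
def fixedSet (ω : E ≃ₗᵢ[ℝ] E) : Set E := {x | ω x = x}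

/-- The fixed-point subspace `E^ω`. -/
def fixedSubmodule (ω : E ≃ₗᵢ[ℝ] E) : Submodule ℝ E :=
  LinearMap.ker ((ω.toLinearEquiv : E →ₗ[ℝ] E) - LinearMap.id)

/-- The folded root system `Φ_re^ω = {β^ω : β ∈ Φ, β^ω ≠ 0}`. -/
noncomputable def foldedRoots (Φ : Set E) (ω : E ≃ₗᵢ[ℝ] E) : Set E :=
  {v | v ≠ 0 ∧ ∃ β ∈ Φ, avg ω β = v}

/-- The `⟨ω⟩`-orbit `O(β) = {ω^t(β) : t ∈ ℤ}`. -/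
def orbitOf (ω : E ≃ₗᵢ[ℝ] E) (β : E) : Set E := {γ | ∃ t : ℤ, (ω ^ t) β = γ}

/-- `N(β) = {γ ∈ O(β) : γ ≠ ±β, (β,γ) ≠ 0}`. -/
def nbrOf (ω : E ≃ₗᵢ[ℝ] E) (β : E) : Set E :=
  {γ | γ ∈ orbitOf ω β ∧ γ ≠ β ∧ γ ≠ -β ∧ ⟪β, γ⟫ ≠ 0}


/-- `Δ^ω`: the averages of the simple roots whose `⟨ω⟩`-orbit avoids `α₀ = -htilde`. -/
noncomputable def simpleAvg (Δ : Finset E) (htilde : E) (ω : E ≃ₗᵢ[ℝ] E) : Set E :=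
  {v | ∃ α ∈ (Δ : Set E), -htilde ∉ orbitOf ω α ∧ avg ω α = v}

/-- `π̄_S = (Σ_{α ∈ S} ϖ_α^∨)^ω` for a subset `S` of `Δ₀`. -/
noncomputable def pibar (ω : E ≃ₗᵢ[ℝ] E) (ϖ : E → E) (S : Set E) : E :=
  avg ω (∑ᶠ γ ∈ S, ϖ γ)

end Folding


open Folding

namespace Folding

variable {E : Type*} [NormedAddCommGroup E] [InnerProductSpace ℝ E]

lemma inner_coroot_left (α x : E) : ⟪coroot α, x⟫ = 2 / ⟪α, α⟫ * ⟪α, x⟫ := by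
  simp [coroot, real_inner_smul_left]

lemma inner_coroot_mul_self {α : E} (hα : α ≠ 0) (x : E) :
    ⟪coroot α, x⟫ * ⟪α, α⟫ = 2 * ⟪α, x⟫ := by
  have h : ⟪α, α⟫ ≠ 0 := inner_self_ne_zero.mpr hα
  rw [inner_coroot_left]
  field_simp

lemma coroot_ne_zero {α : E} (hα : α ≠ 0) : coroot α ≠ 0 := by
  simp [coroot, hα]

lemma coroot_coroot {α : E} (hα : α ≠ 0) : coroot (coroot α) = α := by
  have h : ⟪α, α⟫ ≠ 0 := inner_self_ne_zero.mpr hα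
  simp only [coroot, real_inner_smul_left, real_inner_smul_right, smul_smul]
  convert one_smul ℝ α using 2
  field_simp

lemma inner_smul_eq_inner_smul_coroot (α x : E) :
    ⟪coroot α, x⟫ • α = ⟪α, x⟫ • coroot α := by
  rw [inner_coroot_left, coroot, smul_smul, mul_comm]

lemma inner_reflVec (α x y : E) : ⟪y, reflVec α x⟫ = ⟪reflVec α y, x⟫ := by
  simp only [reflVec, inner_sub_left, inner_sub_right, real_inner_smul_left,
    real_inner_smul_right, inner_coroot_left, real_inner_comm α y]
  ring

lemma reflVec_self {α : E} (hα : α ≠ 0) : reflVec α α = -α := by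
  have h : ⟪α, α⟫ ≠ 0 := inner_self_ne_zero.mpr hα
  have : ⟪coroot α, α⟫ = 2 := by
    rw [inner_coroot_left]
    field_simp
  rw [reflVec, this]
  module

lemma inner_reflVec_reflVec {α : E} (hα : α ≠ 0) (x y : E) :
    ⟪reflVec α x, reflVec α y⟫ = ⟪x, y⟫ := by
  have h : ⟪α, α⟫ ≠ 0 := inner_self_ne_zero.mpr hα
  simp only [reflVec, inner_sub_left, inner_sub_right, real_inner_smul_left,
    real_inner_smul_right, inner_coroot_left, real_inner_comm α x]
  field_simp
  ring

lemma reflVec_smul (α : E) (c : ℝ) (x : E) : reflVec α (c • x) = c • reflVec α x := by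
  simp only [reflVec, real_inner_smul_right]
  module

lemma reflVec_coroot_coroot {α : E} (hα : α ≠ 0) (β : E) :
    reflVec (coroot α) (coroot β) = coroot (reflVec α β) := by
  have h₁ : reflVec (coroot α) (coroot β) = reflVec α (coroot β) := by
    rw [reflVec, coroot_coroot hα, reflVec, inner_smul_eq_inner_smul_coroot]
  rw [h₁, coroot, coroot, reflVec_smul, inner_reflVec_reflVec hα]

/-- A set of nonzero vectors that is stable under its own reflections and has integral Cartan
numbers. -/
structure IsIntegralReflectionSet (Ψ : Set E) : Prop where
  zero_notMem : (0 : E) ∉ Ψ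
  reflVec_mem : ∀ α ∈ Ψ, ∀ β ∈ Ψ, reflVec α β ∈ Ψ
  exists_int : ∀ α ∈ Ψ, ∀ β ∈ Ψ, ∃ n : ℤ, ⟪coroot α, β⟫ = (n : ℝ)

lemma IsRootSystem.isIntegralReflectionSet {Φ : Set E} (h : IsRootSystem Φ) :
    IsIntegralReflectionSet Φ :=
  ⟨h.2.1, h.2.2.2.1, h.2.2.2.2⟩

namespace IsIntegralReflectionSet

variable {Ψ : Set E}

lemma ne_zero (h : IsIntegralReflectionSet Ψ) {α : E} (hα : α ∈ Ψ) : α ≠ 0 :=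
  fun h0 => h.zero_notMem (h0 ▸ hα)

lemma neg_mem (h : IsIntegralReflectionSet Ψ) {α : E} (hα : α ∈ Ψ) : -α ∈ Ψ :=
  reflVec_self (h.ne_zero hα) ▸ h.reflVec_mem α hα α hα

lemma image_coroot (h : IsIntegralReflectionSet Ψ) : IsIntegralReflectionSet (coroot '' Ψ) where
  zero_notMem := by
    rintro ⟨α, hα, h0⟩
    exact coroot_ne_zero (h.ne_zero hα) h0
  reflVec_mem := by
    rintro _ ⟨α, hα, rfl⟩ _ ⟨β, hβ, rfl⟩
    exact ⟨_, h.reflVec_mem α hα β hβ, (reflVec_coroot_coroot (h.ne_zero hα) β).symm⟩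
  exists_int := by
    rintro _ ⟨α, hα, rfl⟩ _ ⟨β, hβ, rfl⟩
    rw [coroot_coroot (h.ne_zero hα), real_inner_comm]
    exact h.exists_int β hβ α hα

lemma add_mem (h : IsIntegralReflectionSet Ψ) {α β : E} (hα : α ∈ Ψ) (hβ : β ∈ Ψ)
    (hneg : ⟪α, β⟫ < 0) (hne : α + β ≠ 0) : α + β ∈ Ψ := by
  have hα0 := h.ne_zero hα
  have hβ0 := h.ne_zero hβ
  have hA : 0 < ⟪α, α⟫ := real_inner_self_pos.mpr hα0
  have hB : 0 < ⟪β, β⟫ := real_inner_self_pos.mpr hβ0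
  obtain ⟨a, ha⟩ := h.exists_int α hα β hβ
  obtain ⟨b, hb⟩ := h.exists_int β hβ α hα
  have ha' := inner_coroot_mul_self hα0 β
  have hb' := inner_coroot_mul_self hβ0 α
  rw [ha] at ha'
  rw [hb, real_inner_comm α β] at hb'
  have ha0 : a < 0 := by
    have : (a : ℝ) < 0 := by nlinarith
    exact_mod_cast this
  have hb0 : b < 0 := by
    have : (b : ℝ) < 0 := by nlinarith
    exact_mod_cast this
  by_cases ha1 : a = -1
  · have := h.reflVec_mem α hα β hβ
    rw [reflVec, ha, ha1] at this
    convert this using 1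
    push_cast
    module
  by_cases hb1 : b = -1
  · have := h.reflVec_mem β hβ α hα
    rw [reflVec, hb, hb1] at this
    convert this using 1
    push_cast
    module
  have ha2 : (a : ℝ) ≤ -2 := by exact_mod_cast (by lia : a ≤ -2)
  have hb2 : (b : ℝ) ≤ -2 := by exact_mod_cast (by lia : b ≤ -2)
  have hpos : 0 < ⟪α + β, α + β⟫ := real_inner_self_pos.mpr hne
  rw [real_inner_add_add_self] at hpos
  nlinarith

lemma multiset_sum_eq_zero (h : IsIntegralReflectionSet Ψ) (M : Multiset E)
    (hM : ∀ a ∈ M, a ∈ Ψ) (hle : ∀ γ ∈ Ψ, ⟪coroot γ, M.sum⟫ ≤ 1) : M.sum = 0 := by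
  classical
  induction hc : M.card using Nat.strong_induction_on generalizing M with
  | _ k ih =>
  subst hc
  induction M using Multiset.induction_on with
  | empty => simp
  | cons a T _ =>
  have ha : a ∈ Ψ := hM a (by simp)
  by_cases hT : ∀ b ∈ T, 0 ≤ ⟪a, b⟫
  · exfalso
    have hsum : 0 ≤ ⟪a, T.sum⟫ := by
      have : ⟪a, T.sum⟫ = (T.map fun b => ⟪a, b⟫).sum :=
        map_multiset_sum (innerₗ E a) T
      rw [this]
      refine Multiset.sum_nonneg fun x hx => ?_
      obtain ⟨b, hb, rfl⟩ := Multiset.mem_map.mp hx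
      exact hT b hb
    have hA : 0 < ⟪a, a⟫ := real_inner_self_pos.mpr (h.ne_zero ha)
    have h1 := hle a ha
    have h2 := inner_coroot_mul_self (h.ne_zero ha) (a ::ₘ T).sum
    rw [Multiset.sum_cons] at h1 h2
    rw [inner_add_right a] at h2
    nlinarith
  · push Not at hT
    obtain ⟨b, hb, hab⟩ := hT
    obtain ⟨T', rfl⟩ := Multiset.exists_cons_of_mem hb
    by_cases h0 : a + b = 0
    · have hs : (a ::ₘ b ::ₘ T').sum = T'.sum := by simp [← add_assoc, h0]
      rw [hs] at hle ⊢
      exact ih _ (by simp) T' (fun c hc => hM c (by simp [hc])) hle rfl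
    · have hs : (a ::ₘ b ::ₘ T').sum = ((a + b) ::ₘ T').sum := by simp [add_assoc]
      rw [hs] at hle ⊢
      refine ih _ (by simp) _ (fun c hc => ?_) hle rfl
      rcases Multiset.mem_cons.mp hc with rfl | hc
      · exact h.add_mem ha (hM b (by simp)) hab h0
      · exact hM c (by simp [hc])

lemma eq_zero_of_mem_closure (h : IsIntegralReflectionSet Ψ) {q : E}
    (hq : q ∈ AddSubgroup.closure Ψ) (hle : ∀ γ ∈ Ψ, ⟪coroot γ, q⟫ ≤ 1) : q = 0 := by
  rw [← AddSubgroup.mem_toAddSubmonoid, AddSubgroup.closure_toAddSubmonoid] at hq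
  obtain ⟨M, hM, rfl⟩ := AddSubmonoid.exists_multiset_of_mem_closure hq
  refine h.multiset_sum_eq_zero M (fun a ha => ?_) hle
  rcases hM a ha with ha | ha
  · exact ha
  · simpa using h.neg_mem ha

end IsIntegralReflectionSet

/-- The coroot lattice `Q^∨`. -/
def corootLattice (Φ : Set E) : AddSubgroup E := AddSubgroup.closure (coroot '' Φ)

/-- `x` lies in the coweight lattice `P^∨`. -/
def IsCoweight (Φ : Set E) (x : E) : Prop := ∀ α ∈ Φ, ∃ k : ℤ, ⟪α, x⟫ = (k : ℝ)

/-- `g` preserves `P^∨` and acts trivially on `P^∨ / Q^∨`. -/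
def ActsTriviallyModCoroots (Φ : Set E) (g : E → E) : Prop :=
  ∀ x, IsCoweight Φ x → IsCoweight Φ (g x) ∧ x - g x ∈ corootLattice Φ

lemma ActsTriviallyModCoroots.comp {Φ : Set E} {f g : E → E}
    (hf : ActsTriviallyModCoroots Φ f) (hg : ActsTriviallyModCoroots Φ g) :
    ActsTriviallyModCoroots Φ (f ∘ g) := fun x hx => by
  obtain ⟨h₁, h₂⟩ := hg x hx
  obtain ⟨h₃, h₄⟩ := hf _ h₁
  refine ⟨h₃, ?_⟩
  simpa using add_mem h₂ h₄

lemma actsTriviallyModCoroots_id (Φ : Set E) : ActsTriviallyModCoroots Φ id :=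
  fun x hx => ⟨hx, by simp⟩

lemma pow_coe (ω : E ≃ₗᵢ[ℝ] E) (m : ℕ) : ⇑(ω ^ m) = ω^[m] :=
  hom_coe_pow _ rfl (fun _ _ => rfl) _ _

lemma ActsTriviallyModCoroots.pow {Φ : Set E} {ω : E ≃ₗᵢ[ℝ] E}
    (h : ActsTriviallyModCoroots Φ ω) (m : ℕ) : ActsTriviallyModCoroots Φ ⇑(ω ^ m) := by
  induction m with
  | zero => exact actsTriviallyModCoroots_id Φ
  | succ m ih =>
    rw [pow_succ]
    exact ih.comp h

lemma IsIntegralReflectionSet.actsTriviallyModCoroots_reflVec {Φ : Set E}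
    (h : IsIntegralReflectionSet Φ) {α : E} (hα : α ∈ Φ) :
    ActsTriviallyModCoroots Φ (reflVec α) := fun x hx => by
  refine ⟨fun β hβ => ?_, ?_⟩
  · rw [inner_reflVec]
    exact hx _ (h.reflVec_mem α hα β hβ)
  · obtain ⟨k, hk⟩ := hx α hα
    rw [reflVec, sub_sub_cancel, inner_smul_eq_inner_smul_coroot, hk, Int.cast_smul_eq_zsmul]
    exact zsmul_mem (AddSubgroup.subset_closure (Set.mem_image_of_mem coroot hα)) k

lemma InWeylGroup.actsTriviallyModCoroots {Φ : Set E} (h : IsIntegralReflectionSet Φ)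
    {ω : E ≃ₗᵢ[ℝ] E} (hω : InWeylGroup Φ ω) : ActsTriviallyModCoroots Φ ω := by
  obtain ⟨l, hl, hωl⟩ := hω
  have key : ActsTriviallyModCoroots Φ fun x => l.foldr reflVec x := by
    clear hωl
    induction l with
    | nil => exact actsTriviallyModCoroots_id Φ
    | cons α l ih =>
      exact (h.actsTriviallyModCoroots_reflVec (hl α (by simp))).comp
        (ih fun β hβ => hl β (by simp [hβ]))
  rwa [← funext hωl] at key

lemma exists_inner_eq [FiniteDimensional ℝ E] {Δ : Finset E}
    (hli : LinearIndependent ℝ (fun α : {x : E // x ∈ Δ} => (α : E)))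
    (hspan : Submodule.span ℝ (Δ : Set E) = ⊤) (f : E → ℝ) :
    ∃ x : E, ∀ β ∈ Δ, ⟪x, β⟫ = f β := by
  let b := Module.Basis.mk hli (by simp [hspan])
  refine ⟨(InnerProductSpace.toDual ℝ E).symm
    (LinearMap.toContinuousLinearMap (b.constr ℝ fun i => f i)), fun β hβ => ?_⟩
  rw [InnerProductSpace.toDual_symm_apply]
  have := b.constr_basis ℝ (fun i => f i) ⟨β, hβ⟩
  simpa [b] using this

lemma IsBaseRS.isCoweight {Φ : Set E} {Δ : Finset E} (hΔ : IsBaseRS Φ Δ) {x : E}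
    (hx : ∀ β ∈ Δ, ∃ k : ℤ, ⟪x, β⟫ = (k : ℝ)) : IsCoweight Φ x := by
  intro γ hγ
  obtain ⟨c, -, hc⟩ := hΔ.2.2.2 γ hγ
  choose! k hk using hx
  refine ⟨∑ β ∈ Δ, c β * k β, ?_⟩
  rw [real_inner_comm, hc, inner_sum]
  push_cast
  exact Finset.sum_congr rfl fun β hβ => by rw [real_inner_smul_right, hk β hβ]

/-- A dominant coweight attains its maximum over the roots at the highest root. -/
lemma inner_le_inner_highest [FiniteDimensional ℝ E] {Φ : Set E} {Δ : Finset E} {h : E}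
    (hΦ : IsRootSystem Φ) (hΔ : IsBaseRS Φ Δ) (hh : h ∈ Φ) {ρ : E}
    (hρ : ∀ β ∈ Δ, ⟪ρ, β⟫ = 1) (hmax : ∀ β ∈ Φ, β ≠ h → ⟪ρ, β⟫ < ⟪ρ, h⟫)
    {n : E → ℝ} (hn : ∀ β ∈ Δ, 0 < n β) (hsum : h = ∑ β ∈ Δ, n β • β)
    {p : E} (hp : ∀ β ∈ Δ, 0 ≤ ⟪p, β⟫) : ∀ γ ∈ Φ, ⟪p, γ⟫ ≤ ⟪p, h⟫ := by
  have hΦ' := hΦ.isIntegralReflectionSet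
  obtain ⟨γ₀, hγ₀, hγ₀max⟩ := Set.exists_max_image Φ (fun γ => ⟪p, γ⟫) hΦ.1 ⟨h, hh⟩
  obtain ⟨γ, ⟨hγ, hγp⟩, hγmax⟩ := Set.exists_max_image {γ ∈ Φ | ⟪p, γ₀⟫ ≤ ⟪p, γ⟫}
    (fun γ => ⟪ρ, γ⟫) (hΦ.1.subset fun _ hx => hx.1) ⟨γ₀, hγ₀, le_rfl⟩
  suffices hle : ⟪p, γ⟫ ≤ ⟪p, h⟫ from fun δ hδ => (hγ₀max δ hδ).trans (hγp.trans hle)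
  have hdom : ∀ β ∈ Δ, 0 ≤ ⟪γ, β⟫ := by
    intro β hβ
    by_contra! hneg
    have hpβ := hp β hβ
    have hρβ := hρ β hβ
    by_cases h0 : γ + β = 0
    · obtain rfl : γ = -β := eq_neg_of_add_eq_zero_left h0
      simp only [inner_neg_right] at hγp hγmax
      have := hγmax β ⟨hΔ.1 hβ, by linarith⟩
      linarith
    · have := hγmax _ ⟨hΦ'.add_mem hγ (hΔ.1 hβ) hneg h0, by rw [inner_add_right]; linarith⟩
      simp only [inner_add_right] at this
      linarith
  have hpos : 0 < ⟪γ, h⟫ := by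
    have heq : ⟪γ, h⟫ = ∑ β ∈ Δ, n β * ⟪γ, β⟫ := by
      rw [hsum, inner_sum]
      simp only [real_inner_smul_right]
    rw [heq]
    refine Finset.sum_pos' (fun β hβ => mul_nonneg (hn β hβ).le (hdom β hβ)) ?_
    by_contra! hall
    refine hΦ'.ne_zero hγ (inner_self_eq_zero (𝕜 := ℝ).mp ?_)
    obtain ⟨c, -, hc⟩ := hΔ.2.2.2 γ hγ
    have hz : ⟪γ, ∑ β ∈ Δ, (c β : ℝ) • β⟫ = 0 := by
      rw [inner_sum]
      refine Finset.sum_eq_zero fun β hβ => ?_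
      rw [real_inner_smul_right]
      have : ⟪γ, β⟫ = 0 := by
        have h1 := hall β hβ
        have h2 := hn β hβ
        have h3 := hdom β hβ
        nlinarith
      rw [this, mul_zero]
    rwa [← hc] at hz
  by_cases hγh : γ = h
  · rw [hγh]
  have hmem : γ + -h ∈ Φ := hΦ'.add_mem hγ (hΦ'.neg_mem hh) (by simpa using hpos)
    (by rwa [← sub_eq_add_neg, sub_ne_zero])
  have hlt := hmax γ hγ hγh
  obtain ⟨c, hc, hceq⟩ := hΔ.2.2.2 _ hmem
  have hval : ∀ x : E, ⟪x, γ⟫ - ⟪x, h⟫ = ∑ β ∈ Δ, (c β : ℝ) * ⟪x, β⟫ := by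
    intro x
    rw [← inner_sub_right, sub_eq_add_neg, hceq, inner_sum]
    simp only [real_inner_smul_right]
  rcases hc with hc | hc
  · have : 0 ≤ ⟪ρ, γ⟫ - ⟪ρ, h⟫ := by
      rw [hval]
      refine Finset.sum_nonneg fun β hβ => ?_
      rw [hρ β hβ, mul_one]
      exact_mod_cast hc β
    linarith
  · have : ⟪p, γ⟫ - ⟪p, h⟫ ≤ 0 := by
      rw [hval]
      refine Finset.sum_nonpos fun β hβ => ?_
      exact mul_nonpos_of_nonpos_of_nonneg (by exact_mod_cast hc β) (hp β hβ)
    linarith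

lemma pow_image_eq {ω : E ≃ₗᵢ[ℝ] E} {D : Set E} (h : ω '' D = D) (m : ℕ) :
    ⇑(ω ^ m) '' D = D := by
  induction m with
  | zero => simp
  | succ m ih =>
    rw [pow_succ, LinearIsometryEquiv.coe_mul, Set.image_comp, h, ih]

/-- If `τ` acts trivially on `P^∨ / Q^∨`, preserves the extended base and fixes the simple root
`α`, then `τ` to the power of the mark of `α` fixes `-h`. -/
lemma pow_mark_apply_neg_highest [FiniteDimensional ℝ E] {Φ : Set E} {Δ : Finset E} {h : E}
    (hΦ : IsRootSystem Φ) (hΔ : IsBaseRS Φ Δ) (hh : h ∈ Φ) {ρ : E}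
    (hρ : ∀ β ∈ Δ, ⟪ρ, β⟫ = 1) (hmax : ∀ β ∈ Φ, β ≠ h → ⟪ρ, β⟫ < ⟪ρ, h⟫)
    {n : E → ℝ} (hn : ∀ β ∈ Δ, 0 < n β) (hsum : h = ∑ β ∈ Δ, n β • β)
    (hnotMem : -h ∉ Δ) {τ : E ≃ₗᵢ[ℝ] E} (hτ : ActsTriviallyModCoroots Φ τ)
    (hτD : τ '' (↑Δ ∪ {-h}) = ↑Δ ∪ {-h}) {α : E} (hα : α ∈ Δ) (hτα : τ α = α)
    {N : ℕ} (hN : n α = N) (hone : (τ ^ N) (-h) ∈ Δ → n ((τ ^ N) (-h)) = 1) :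
    (τ ^ N) (-h) = -h := by
  classical
  have hN0 : (N : ℝ) ≠ 0 := hN ▸ (hn α hα).ne'
  have inner_h (x : E) : ⟪x, h⟫ = ∑ β ∈ Δ, n β * ⟪x, β⟫ := by
    conv_lhs => rw [hsum]
    rw [inner_sum]
    simp only [real_inner_smul_right]
  obtain ⟨ϖ, hϖ⟩ := exists_inner_eq hΔ.2.1 hΔ.2.2.1 fun β => if β = α then (1 : ℝ) else 0
  have hϖh : ⟪ϖ, h⟫ = N := by
    rw [inner_h, ← hN, Finset.sum_congr rfl fun β hβ => by rw [hϖ β hβ]]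
    simp [hα]
  have hταm (m : ℕ) : (τ ^ m) α = α := by
    induction m with
    | zero => simp
    | succ m ih => rw [pow_succ, LinearIsometryEquiv.coe_mul, Function.comp_apply, hτα, ih]
  let p (m : ℕ) : E := (N : ℝ)⁻¹ • (ϖ - (τ ^ m) ϖ)
  have hp (m : ℕ) : ∀ β ∈ Δ, ⟪p m, β⟫ = if β = (τ ^ m) (-h) then (1 : ℝ) else 0 := by
    intro β hβ
    have hβD : β ∈ ⇑(τ ^ m) '' ((Δ : Set E) ∪ {-h}) := by
      rw [pow_image_eq hτD]
      exact Or.inl hβ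
    obtain ⟨β', hβ', rfl⟩ := hβD
    simp only [p, real_inner_smul_left, inner_sub_left, LinearIsometryEquiv.inner_map_map,
      EmbeddingLike.apply_eq_iff_eq]
    rw [hϖ _ hβ]
    have hiff : (τ ^ m) β' = α ↔ β' = α := by
      conv_lhs => rw [← hταm m]
      exact EmbeddingLike.apply_eq_iff_eq _
    simp only [hiff]
    rcases hβ' with hβ' | rfl
    · rw [hϖ _ hβ', sub_self, mul_zero, if_neg]
      rintro rfl
      exact hnotMem hβ'
    · rw [if_neg fun he : -h = α => hnotMem (he ▸ hα), inner_neg_right, hϖh]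
      simp [hN0]
  have hpco (m : ℕ) : IsCoweight Φ (p m) := hΔ.isCoweight fun β hβ => by
    rw [hp m β hβ]
    split_ifs
    · exact ⟨1, by simp⟩
    · exact ⟨0, by simp⟩
  have hϖco : IsCoweight Φ ϖ := hΔ.isCoweight fun β hβ => by
    rw [hϖ β hβ]
    split_ifs
    · exact ⟨1, by simp⟩
    · exact ⟨0, by simp⟩
  have hcocycle (m : ℕ) : p m - m • p 1 ∈ corootLattice Φ := by
    induction m with
    | zero => simp [p]
    | succ m ih =>
      have hstep : p (m + 1) - p m = (τ ^ m) (p 1) := by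
        simp only [p, map_smul, map_sub, pow_succ, pow_zero, one_mul,
          LinearIsometryEquiv.coe_mul, Function.comp_apply]
        module
      have heq : p (m + 1) - (m + 1) • p 1 = (p m - m • p 1) - (p 1 - (τ ^ m) (p 1)) := by
        rw [← hstep]
        module
      rw [heq]
      exact sub_mem ih (hτ.pow m _ (hpco 1)).2
  have hpN : p N ∈ corootLattice Φ := by
    have hNp : N • p 1 ∈ corootLattice Φ := by
      have : N • p 1 = ϖ - τ ϖ := by
        simp only [p, pow_one]
        rw [← Nat.cast_smul_eq_nsmul ℝ, smul_smul, mul_inv_cancel₀ hN0, one_smul]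
      rw [this]
      exact (hτ ϖ hϖco).2
    simpa using add_mem (hcocycle N) hNp
  by_contra hne
  have hmem : (τ ^ N) (-h) ∈ Δ := by
    have : (τ ^ N) (-h) ∈ (Δ : Set E) ∪ {-h} := by
      rw [← pow_image_eq hτD N]
      exact ⟨-h, by simp, rfl⟩
    exact this.resolve_right hne
  have hph : ⟪p N, h⟫ = 1 := by
    rw [inner_h, Finset.sum_congr rfl fun β hβ => by rw [hp N β hβ]]
    simp only [mul_ite, mul_one, mul_zero, Finset.sum_ite_eq', hmem, if_true, hone hmem]
  have hle := inner_le_inner_highest hΦ hΔ hh hρ hmax hn hsum (p := p N) fun β hβ => by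
    rw [hp N β hβ]
    split_ifs <;> norm_num
  have hzero : p N = 0 := by
    have hΦ' := hΦ.isIntegralReflectionSet
    refine hΦ'.image_coroot.eq_zero_of_mem_closure hpN ?_
    rintro _ ⟨γ, hγ, rfl⟩
    rw [coroot_coroot (hΦ'.ne_zero hγ), real_inner_comm, ← hph]
    exact hle γ hγ
  rw [hzero, inner_zero_left] at hph
  exact zero_ne_one hph

lemma sum_comp_eq_of_image_eq {ι M : Type*} [DecidableEq ι] [AddCommMonoid M] {g : ι → ι}
    (hg : Function.Injective g) {D : Finset ι} (hD : D.image g = D) (f : ι → M) :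
    ∑ i ∈ D, f (g i) = ∑ i ∈ D, f i := by
  conv_rhs => rw [← hD]
  rw [Finset.sum_image fun _ _ _ _ h => hg h]

/-- The marks are constant along the action of an isometry preserving the extended base. -/
lemma mark_apply_eq {Δ : Finset E} {h : E} [FiniteDimensional ℝ E]
    (hli : LinearIndependent ℝ (fun α : {x : E // x ∈ Δ} => (α : E)))
    (hspan : Submodule.span ℝ (Δ : Set E) = ⊤) (hnotMem : -h ∉ Δ)
    {n : E → ℝ} (hn0 : n (-h) = 1) (hn : ∀ β ∈ Δ, 0 < n β) (hsum : h = ∑ β ∈ Δ, n β • β)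
    {ω : E ≃ₗᵢ[ℝ] E} (hω : ω '' (↑Δ ∪ {-h}) = ↑Δ ∪ {-h}) :
    ∀ β ∈ (↑Δ ∪ {-h} : Set E), n (ω β) = n β := by
  classical
  let D : Finset E := insert (-h) Δ
  have hD (x : E) : x ∈ D ↔ x ∈ (↑Δ ∪ {-h} : Set E) := by simp [D, or_comm]
  have himg : D.image ω = D := by
    ext x
    rw [hD, ← hω]
    simp only [Finset.mem_image, hD, Set.mem_image]
  have hrel : ∑ β ∈ D, n β • β = 0 := by
    rw [Finset.sum_insert hnotMem, ← hsum, hn0]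
    simp
  have hrel' : ∑ β ∈ D, n (ω β) • β = 0 := by
    apply ω.injective
    rw [map_sum, map_zero, ← hrel, ← sum_comp_eq_of_image_eq ω.injective himg fun β => n β • β]
    simp only [map_smul]
  have hprop : ∀ β ∈ D, n (ω β) = n (ω (-h)) * n β := by
    intro β hβ
    rcases Finset.mem_insert.mp hβ with rfl | hβ
    · rw [hn0, mul_one]
    obtain ⟨x, hx⟩ := exists_inner_eq hli hspan fun γ => if γ = β then (1 : ℝ) else 0
    have hval (c : E → ℝ) : ⟪x, ∑ γ ∈ Δ, c γ • γ⟫ = c β := by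
      simp only [inner_sum, real_inner_smul_right]
      rw [Finset.sum_congr rfl fun γ hγ => by rw [hx γ hγ]]
      simp [hβ]
    have hxh : ⟪x, h⟫ = n β := by
      conv_lhs => rw [hsum]
      exact hval n
    have := congrArg (fun y => ⟪x, y⟫) hrel'
    simp only [D, Finset.sum_insert hnotMem, inner_add_right, hval fun γ => n (ω γ),
      real_inner_smul_right, inner_neg_right, hxh, inner_zero_right] at this
    linarith
  have hone : n (ω (-h)) = 1 := by
    have h1 := sum_comp_eq_of_image_eq ω.injective himg n
    rw [Finset.sum_congr rfl hprop, ← Finset.mul_sum] at h1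
    have hpos : 0 < ∑ β ∈ D, n β := by
      rw [Finset.sum_insert hnotMem, hn0]
      exact add_pos_of_pos_of_nonneg one_pos (Finset.sum_nonneg fun β hβ => (hn β hβ).le)
    exact (mul_eq_right₀ hpos.ne').mp h1
  intro β hβ
  rw [hprop β ((hD β).mpr hβ), hone, one_mul]

lemma mem_periodicPts_of_image_eq {ω : E ≃ₗᵢ[ℝ] E} {D : Set E} (hfin : D.Finite)
    (hω : ω '' D = D) {x : E} (hx : x ∈ D) : x ∈ Function.periodicPts ω := by
  have hmem (m : ℕ) : ω^[m] x ∈ D := by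
    have hmaps : Set.MapsTo ω D D := fun y hy => hω ▸ Set.mem_image_of_mem ω hy
    exact hmaps.iterate m hx
  obtain ⟨i, j, hij, heq⟩ := hfin.exists_lt_map_eq_of_forall_mem hmem
  refine Function.mk_mem_periodicPts (Nat.sub_pos_of_lt hij) ?_
  exact (Function.iterate_cancel ω.injective heq.symm)

lemma orbitOf_eq_image {ω : E ≃ₗᵢ[ℝ] E} {x : E} (hx : x ∈ Function.periodicPts ω) :
    orbitOf ω x =
      (fun i => ω^[i] x) '' (Finset.range (Function.minimalPeriod ω x) : Set ℕ) := by
  set s := Function.minimalPeriod ω x with hs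
  have hs0 : 0 < s := Function.minimalPeriod_pos_of_mem_periodicPts hx
  have hper : (ω ^ s) x = x := by
    rw [pow_coe]
    exact Function.iterate_minimalPeriod
  have hperz (t : ℤ) : ((ω ^ s) ^ t) x = x := by
    induction t using Int.induction_on with
    | zero => simp
    | succ i ih =>
      rw [zpow_add_one, LinearIsometryEquiv.coe_mul, Function.comp_apply, hper, ih]
    | pred i ih =>
      rw [zpow_sub_one, LinearIsometryEquiv.coe_mul, Function.comp_apply]
      nth_rewrite 1 [← hper]
      rw [← Function.comp_apply (f := ⇑(ω ^ s)⁻¹), ← LinearIsometryEquiv.coe_mul]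
      simpa only [inv_mul_cancel, LinearIsometryEquiv.coe_one, id] using ih
  ext y
  constructor
  · rintro ⟨t, rfl⟩
    have hs' : (s : ℤ) ≠ 0 := by positivity
    have hmod := Int.emod_nonneg t hs'
    have hlt := Int.emod_lt_of_pos t (by positivity : (0 : ℤ) < s)
    refine ⟨(t % s).toNat, ?_, ?_⟩
    · simp only [Finset.coe_range, Set.mem_Iio]
      lia
    · have ht : ω ^ t = ω ^ (t % s).toNat * (ω ^ s) ^ (t / s) := by
        rw [← zpow_natCast, ← zpow_natCast, ← zpow_mul, ← zpow_add, Int.toNat_of_nonneg hmod,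
          Int.emod_add_mul_ediv]
      rw [ht, LinearIsometryEquiv.coe_mul, Function.comp_apply, hperz,
        pow_coe]
  · rintro ⟨i, -, rfl⟩
    exact ⟨i, by rw [zpow_natCast, pow_coe]⟩

lemma injOn_iterate_range_minimalPeriod (ω : E ≃ₗᵢ[ℝ] E) (x : E) :
    Set.InjOn (fun i => ω^[i] x) (Finset.range (Function.minimalPeriod ω x) : Set ℕ) := by
  rw [Finset.coe_range]
  exact Function.iterate_injOn_Iio_minimalPeriod

end Folding

theorem orbit_mark_sum_divisible
    {E : Type*} [NormedAddCommGroup E] [InnerProductSpace ℝ E] [FiniteDimensional ℝ E]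
    (Φ : Set E) (Δ : Finset E) (coeff : E → E → ℝ) (htilde : E) (ω : E ≃ₗᵢ[ℝ] E)
    (hΦrs : IsRootSystem Φ) (hΦred : IsReducedRS Φ) (hΦirr : IsIrreducibleRS Φ)
    (hΔ : IsBaseRS Φ Δ)
    (hcoeff : ∀ β ∈ Φ, β = ∑ α ∈ Δ, coeff β α • α)
    (hht : htilde ∈ Φ)
    (hhighest : ∀ β ∈ Φ, β ≠ htilde → ∑ α ∈ Δ, coeff β α < ∑ α ∈ Δ, coeff htilde α)
    (hωW : InWeylGroup Φ ω)
    (hωΔ₀ : ⇑ω '' (↑Δ ∪ {-htilde}) = ↑Δ ∪ {-htilde})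
    (n : E → ℤ) (hn0 : n (-htilde) = 1)
    (hnΔ : ∀ α ∈ Δ, (n α : ℝ) = coeff htilde α)
    (hnpos : ∀ α ∈ (↑Δ ∪ {-htilde} : Set E), 0 < n α) :
    ∀ α ∈ (↑Δ ∪ {-htilde} : Set E), ∃ m : ℤ, 0 < m ∧
      ∑ᶠ β ∈ orbitOf ω α, n β = m * ((orbitOf ω (-htilde)).ncard : ℤ) := by
  classical
  let n' : E → ℝ := fun β => (n β : ℝ)
  have hsum : htilde = ∑ β ∈ Δ, n' β • β := by
    conv_lhs => rw [hcoeff htilde hht]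
    exact Finset.sum_congr rfl fun β hβ => by rw [← hnΔ β hβ]
  have hn'pos : ∀ β ∈ Δ, 0 < n' β := fun β hβ => Int.cast_pos.mpr (hnpos β (Or.inl hβ))
  have hn'0 : n' (-htilde) = 1 := by simp [n', hn0]
  have hcoeffsum (x : E) {γ : E} (hγ : γ ∈ Φ) : ⟪x, γ⟫ = ∑ β ∈ Δ, coeff γ β * ⟪x, β⟫ := by
    conv_lhs => rw [hcoeff γ hγ]
    simp only [inner_sum, real_inner_smul_right]
  obtain ⟨ρ, hρ⟩ := exists_inner_eq hΔ.2.1 hΔ.2.2.1 fun _ => (1 : ℝ)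
  have hρsum {γ : E} (hγ : γ ∈ Φ) : ⟪ρ, γ⟫ = ∑ β ∈ Δ, coeff γ β := by
    rw [hcoeffsum ρ hγ]
    exact Finset.sum_congr rfl fun β hβ => by rw [hρ β hβ, mul_one]
  have hmax : ∀ β ∈ Φ, β ≠ htilde → ⟪ρ, β⟫ < ⟪ρ, htilde⟫ := fun β hβ hne => by
    rw [hρsum hβ, hρsum hht]
    exact hhighest β hβ hne
  have hnotMem : -htilde ∉ Δ := by
    intro hmem
    have h1 : ⟪ρ, htilde⟫ = -1 := by
      have := hρ _ hmem
      rw [inner_neg_right] at this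
      linarith
    have h2 : 0 < ⟪ρ, htilde⟫ := by
      rw [hρsum hht]
      exact Finset.sum_pos (fun β hβ => hnΔ β hβ ▸ hn'pos β hβ) ⟨_, hmem⟩
    linarith
  have hfin : (↑Δ ∪ {-htilde} : Set E).Finite := Δ.finite_toSet.union (Set.finite_singleton _)
  have hinv := mark_apply_eq hΔ.2.1 hΔ.2.2.1 hnotMem hn'0 hn'pos hsum hωΔ₀
  have hmaps : Set.MapsTo ω (↑Δ ∪ {-htilde} : Set E) (↑Δ ∪ {-htilde}) :=
    fun y hy => hωΔ₀ ▸ Set.mem_image_of_mem ω hy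
  have hinvit {β : E} (hβ : β ∈ (↑Δ ∪ {-htilde} : Set E)) (m : ℕ) : n (ω^[m] β) = n β := by
    induction m with
    | zero => rfl
    | succ m ih =>
      rw [Function.iterate_succ_apply', ← ih]
      exact Int.cast_injective (hinv _ (hmaps.iterate m hβ))
  have h0 : -htilde ∈ (↑Δ ∪ {-htilde} : Set E) := by simp
  have hperiodic {β : E} (hβ : β ∈ (↑Δ ∪ {-htilde} : Set E)) :=
    mem_periodicPts_of_image_eq hfin hωΔ₀ hβ
  intro α hα
  set s := Function.minimalPeriod ω α with hs
  have hs0 : 0 < s := Function.minimalPeriod_pos_of_mem_periodicPts (hperiodic hα)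
  obtain ⟨N, hN⟩ := Int.eq_ofNat_of_zero_le (hnpos α hα).le
  have horbitsum : ∑ᶠ β ∈ orbitOf ω α, n β = (s * N : ℕ) := by
    rw [orbitOf_eq_image (hperiodic hα),
      finsum_mem_image (injOn_iterate_range_minimalPeriod ω α), finsum_mem_coe_finset,
      Finset.sum_congr rfl fun i _ => hinvit hα i, hN]
    simp [hs]
  have hcard : (orbitOf ω (-htilde)).ncard = Function.minimalPeriod ω (-htilde) := by
    rw [orbitOf_eq_image (hperiodic h0),
      (injOn_iterate_range_minimalPeriod ω _).ncard_image, Set.ncard_coe_finset,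
      Finset.card_range]
  have hfix : (ω ^ (s * N)) (-htilde) = -htilde := by
    rcases hα with hα | rfl
    · rw [pow_mul]
      refine pow_mark_apply_neg_highest hΦrs hΔ hht hρ hmax hn'pos hsum hnotMem
        ((hωW.actsTriviallyModCoroots hΦrs.isIntegralReflectionSet).pow s)
        (pow_image_eq hωΔ₀ s) hα ?_ (by simp [n', hN]) fun _ => ?_
      · rw [pow_coe]
        exact Function.iterate_minimalPeriod
      · rw [← pow_mul, pow_coe]
        simp only [n', hinvit h0, hn0, Int.cast_one]
    · obtain rfl : N = 1 := by lia
      rw [mul_one, pow_coe]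
      exact Function.iterate_minimalPeriod
  have hdvd : (orbitOf ω (-htilde)).ncard ∣ s * N := by
    rw [hcard]
    refine Function.IsPeriodicPt.minimalPeriod_dvd ?_
    rwa [pow_coe] at hfix
  obtain ⟨m, hm⟩ := hdvd
  have hNpos : 0 < N := by
    have := hnpos α hα
    lia
  refine ⟨m, ?_, ?_⟩
  · have : m ≠ 0 := by
      rintro rfl
      rw [mul_zero] at hm
      exact (Nat.mul_pos hs0 hNpos).ne' hm
    lia
  · rw [horbitsum, hm, mul_comm]
    push_cast
    rfl
end

section
/- If some α ∈ Δ satisfies #N(α) = 1, then 2·α^ω ∈ Φ_re^ω; in particular, Φ_re^ω is a non-reduced root system. -/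
open scoped RealInnerProductSpace

namespace Folding

section Averages

variable {E : Type*} [NormedAddCommGroup E] [InnerProductSpace ℝ E]

theorem avg_add (ω : E ≃ₗᵢ[ℝ] E) (x y : E) : avg ω (x + y) = avg ω x + avg ω y := by
  simp [avg, Finset.sum_add_distrib]

theorem avg_sum {ι : Type*} (ω : E ≃ₗᵢ[ℝ] E) (s : Finset ι) (f : ι → E) :
    avg ω (∑ i ∈ s, f i) = ∑ i ∈ s, avg ω (f i) := by
  simp only [avg, map_sum, ← Finset.smul_sum]
  rw [Finset.sum_comm]

theorem avg_apply (ω : E ≃ₗᵢ[ℝ] E) (x : E) : avg ω (ω x) = avg ω x := by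
  have h (t : ℕ) : (ω ^ (t + 1)) (ω x) = (ω ^ (t + 1 + 1)) x := by
    rw [pow_succ ω (t + 1), LinearIsometryEquiv.coe_mul, Function.comp_apply]
  unfold avg
  congr 1
  rw [Finset.sum_congr rfl fun t _ => h t]
  have h1 := Finset.sum_range_succ (fun t => (ω ^ (t + 1)) x) (orderOf ω)
  have h2 := Finset.sum_range_succ' (fun t => (ω ^ (t + 1)) x) (orderOf ω)
  have h3 : (ω ^ (orderOf ω + 1)) x = (ω ^ (0 + 1)) x := by
    rw [pow_succ, pow_orderOf_eq_one, one_mul, zero_add, pow_one]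
  rw [h1, h3] at h2
  exact (add_right_cancel h2).symm

theorem avg_zpow_apply (ω : E ≃ₗᵢ[ℝ] E) (t : ℤ) (x : E) : avg ω ((ω ^ t) x) = avg ω x := by
  induction t with
  | zero => simp
  | succ n ih =>
    rw [add_comm, zpow_add, zpow_one, LinearIsometryEquiv.coe_mul, Function.comp_apply,
      avg_apply, ih]
  | pred n ih =>
    rw [← ih, ← avg_apply ω ((ω ^ (-(n : ℤ) - 1)) x), ← Function.comp_apply (f := ω),
      ← LinearIsometryEquiv.coe_mul, ← zpow_one_add, add_sub_cancel]

theorem avg_of_apply_eq {ω : E ≃ₗᵢ[ℝ] E} (hω : IsOfFinOrder ω) {x : E} (hx : ω x = x) :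
    avg ω x = x := by
  have h (t : ℕ) : (ω ^ t) x = x := by
    induction t with
    | zero => simp
    | succ n ih => rw [pow_succ, LinearIsometryEquiv.coe_mul, Function.comp_apply, hx, ih]
  have h0 : (orderOf ω : ℝ) ≠ 0 := by exact_mod_cast hω.orderOf_pos.ne'
  simp only [avg, h, Finset.sum_const, Finset.card_range, ← Nat.cast_smul_eq_nsmul ℝ]
  rw [smul_smul, inv_mul_cancel₀ h0, one_smul]

theorem zpow_apply_mem {ω : E ≃ₗᵢ[ℝ] E} {S : Set E} (h : ω '' S = S) (t : ℤ) {x : E}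
    (hx : x ∈ S) : (ω ^ t) x ∈ S := by
  induction t with
  | zero => simpa using hx
  | succ n ih =>
    rw [add_comm, zpow_add, zpow_one, LinearIsometryEquiv.coe_mul, Function.comp_apply, ← h]
    exact Set.mem_image_of_mem _ ih
  | pred n ih =>
    rw [← h] at ih
    obtain ⟨y, hy, hyx⟩ := ih
    have : ω ((ω ^ (-(n : ℤ) - 1)) x) = ω y := by
      rw [hyx, ← Function.comp_apply (f := ω), ← LinearIsometryEquiv.coe_mul, ← zpow_one_add,
        add_sub_cancel]
    rwa [ω.injective this]

theorem orbitOf_subset {ω : E ≃ₗᵢ[ℝ] E} {S : Set E} (h : ω '' S = S) {x : E} (hx : x ∈ S) :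
    orbitOf ω x ⊆ S := by
  rintro _ ⟨t, rfl⟩
  exact zpow_apply_mem h t hx

theorem apply_mem_orbitOf {ω : E ≃ₗᵢ[ℝ] E} {x y : E} (hy : y ∈ orbitOf ω x) :
    ω y ∈ orbitOf ω x := by
  obtain ⟨t, rfl⟩ := hy
  exact ⟨1 + t, by rw [zpow_add, zpow_one, LinearIsometryEquiv.coe_mul, Function.comp_apply]⟩

/-- An isometry permuting a finite spanning set has finite order. -/
theorem isOfFinOrder_of_image_eq {ω : E ≃ₗᵢ[ℝ] E} {S : Set E} (hS : S.Finite)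
    (hspan : Submodule.span ℝ S = ⊤) (h : ω '' S = S) : IsOfFinOrder ω := by
  by_contra hω
  have hinj := injective_pow_iff_not_isOfFinOrder.2 hω
  have : Finite S := hS
  let f : ℕ → S → S := fun n x => ⟨(ω ^ n) x, by simpa using zpow_apply_mem h n x.2⟩
  refine not_injective_infinite_finite f fun m n hmn => hinj ?_
  have hlin : ((ω ^ m).toLinearEquiv : E →ₗ[ℝ] E) = (ω ^ n).toLinearEquiv := by
    refine LinearMap.ext_on hspan fun x hx => ?_
    exact congrArg Subtype.val (congrFun hmn ⟨x, hx⟩)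
  ext x
  exact LinearMap.congr_fun hlin x

/-- If the average of `x` vanishes, then so does the sum over the (finite) orbit of `x`. -/
theorem sum_orbit_eq_zero {ω : E ≃ₗᵢ[ℝ] E} (hω : IsOfFinOrder ω) {x : E} {O : Finset E}
    (hO : (O : Set E) = orbitOf ω x) (hx : avg ω x = 0) : ∑ y ∈ O, y = 0 := by
  classical
  have hmem (y : E) : y ∈ O ↔ y ∈ orbitOf ω x := by rw [← hO, Finset.mem_coe]
  have himage : O.image ω = O := by
    refine Finset.eq_of_subset_of_card_le (fun y hy => ?_)
      (Finset.card_image_of_injective O ω.injective).ge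
    obtain ⟨z, hz, rfl⟩ := Finset.mem_image.1 hy
    exact (hmem _).2 (apply_mem_orbitOf ((hmem z).1 hz))
  have hfix : ω (∑ y ∈ O, y) = ∑ y ∈ O, y := by
    conv_rhs => rw [← himage, Finset.sum_image ω.injective.injOn]
    rw [map_sum]
  rw [← avg_of_apply_eq hω hfix, avg_sum]
  refine Finset.sum_eq_zero fun y hy => ?_
  obtain ⟨t, rfl⟩ := (hmem y).1 hy
  rw [avg_zpow_apply, hx]

end Averages

section Roots

variable {E : Type*} [NormedAddCommGroup E] [InnerProductSpace ℝ E]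

theorem inner_coroot (α x : E) : ⟪coroot α, x⟫ = 2 * ⟪α, x⟫ / ⟪α, α⟫ := by
  rw [coroot, real_inner_smul_left]
  ring

theorem IsRootSystem.inner_self_pos {Φ : Set E} (hΦ : IsRootSystem Φ) {α : E} (hα : α ∈ Φ) :
    0 < ⟪α, α⟫ :=
  real_inner_self_pos.2 fun h => hΦ.2.1 (h ▸ hα)

theorem IsRootSystem.neg_mem {Φ : Set E} (hΦ : IsRootSystem Φ) {α : E} (hα : α ∈ Φ) :
    -α ∈ Φ := by
  have h := hΦ.2.2.2.1 α hα α hα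
  rwa [reflVec, inner_coroot, mul_div_assoc, div_self (hΦ.inner_self_pos hα).ne', mul_one,
    two_smul, sub_add_cancel_left] at h

theorem IsBaseRS.coeff_unique {Φ : Set E} {Δ : Finset E} (hΔ : IsBaseRS Φ Δ) {c d : E → ℝ}
    (h : ∑ α ∈ Δ, c α • α = ∑ α ∈ Δ, d α • α) {α : E} (hα : α ∈ Δ) : c α = d α := by
  have h0 : ∑ i : {x : E // x ∈ Δ}, (c i - d i) • (i : E) = 0 := by
    rw [Finset.sum_coe_sort Δ fun x => (c x - d x) • x]
    simp only [sub_smul, Finset.sum_sub_distrib, h, sub_self]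
  exact sub_eq_zero.1 (Fintype.linearIndependent_iff.1 hΔ.2.1 _ h0 ⟨α, hα⟩)

/-- Distinct simple roots form a non-acute angle. -/
theorem IsBaseRS.inner_nonpos {Φ : Set E} {Δ : Finset E} (hΦ : IsRootSystem Φ)
    (hΔ : IsBaseRS Φ Δ) {α β : E} (hα : α ∈ Δ) (hβ : β ∈ Δ) (hne : α ≠ β) :
    ⟪α, β⟫ ≤ 0 := by
  classical
  by_contra! hpos
  have hm : 0 < ⟪coroot α, β⟫ := by
    have := hΦ.inner_self_pos (hΔ.1 hα)
    rw [inner_coroot]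
    positivity
  obtain ⟨c, hc, hsum⟩ := hΔ.2.2.2 _ (hΦ.2.2.2.1 α (hΔ.1 hα) β (hΔ.1 hβ))
  have hsum' : ∑ δ ∈ Δ, (c δ : ℝ) • δ =
      ∑ δ ∈ Δ, ((if δ = β then 1 else 0) - if δ = α then ⟪coroot α, β⟫ else 0 : ℝ) • δ := by
    rw [← hsum]
    simp [sub_smul, Finset.sum_sub_distrib, ite_smul, hα, hβ, reflVec]
  have h1 := hΔ.coeff_unique hsum' hα
  have h2 := hΔ.coeff_unique hsum' hβ
  simp only [hne, hne.symm, if_true, if_false, zero_sub, sub_zero] at h1 h2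
  rcases hc with hc | hc
  · have : (0 : ℝ) ≤ c α := by exact_mod_cast hc α
    linarith
  · have : (c β : ℝ) ≤ 0 := by exact_mod_cast hc β
    linarith

/-- The highest root is dominant. -/
theorem inner_highest_nonneg {Φ : Set E} {Δ : Finset E} (hΦ : IsRootSystem Φ)
    (hΔ : IsBaseRS Φ Δ) {coeff : E → E → ℝ} (hcoeff : ∀ β ∈ Φ, β = ∑ α ∈ Δ, coeff β α • α)
    {θ : E} (hθ : θ ∈ Φ)
    (hhighest : ∀ β ∈ Φ, β ≠ θ → ∑ α ∈ Δ, coeff β α < ∑ α ∈ Δ, coeff θ α)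
    {α : E} (hα : α ∈ Δ) : 0 ≤ ⟪α, θ⟫ := by
  classical
  by_contra! hneg
  have hαα := hΦ.inner_self_pos (hΔ.1 hα)
  have hm : ⟪coroot α, θ⟫ < 0 := by
    rw [inner_coroot]
    exact div_neg_of_neg_of_pos (by linarith) hαα
  have hr := hΦ.2.2.2.1 α (hΔ.1 hα) θ hθ
  have hne : reflVec α θ ≠ θ := by
    rw [reflVec, Ne, sub_eq_self, smul_eq_zero, not_or]
    exact ⟨hm.ne, real_inner_self_pos.1 hαα⟩
  have hsum : ∑ δ ∈ Δ, coeff (reflVec α θ) δ • δ =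
      ∑ δ ∈ Δ, (coeff θ δ - if δ = α then ⟪coroot α, θ⟫ else 0) • δ := by
    rw [← hcoeff _ hr]
    simp only [sub_smul, Finset.sum_sub_distrib, ← hcoeff θ hθ]
    simp [ite_smul, hα, reflVec]
  have hlt := hhighest _ hr hne
  rw [Finset.sum_congr rfl fun δ hδ => hΔ.coeff_unique hsum hδ, Finset.sum_sub_distrib,
    Finset.sum_ite_eq' Δ α, if_pos hα] at hlt
  linarith

/-- Two roots of equal length at an obtuse angle, not opposite, span an angle of `2π/3`. -/
theorem IsRootSystem.inner_coroot_eq_neg_one {Φ : Set E} (hΦ : IsRootSystem Φ) {α γ : E}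
    (hα : α ∈ Φ) (hγ : γ ∈ Φ) (hlen : ⟪γ, γ⟫ = ⟪α, α⟫) (hne : γ ≠ -α) (hneg : ⟪α, γ⟫ < 0) :
    ⟪coroot α, γ⟫ = -1 := by
  have hαα := hΦ.inner_self_pos hα
  obtain ⟨n, hn⟩ := hΦ.2.2.2.2 α hα γ hγ
  have hn' := hn
  rw [inner_coroot, div_eq_iff hαα.ne'] at hn'
  have hpos : 0 < ⟪α + γ, α + γ⟫ :=
    real_inner_self_pos.2 fun h => hne (eq_neg_of_add_eq_zero_right h)
  rw [real_inner_add_add_self, hlen] at hpos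
  have h1 : (n : ℝ) < 0 := by
    by_contra! h
    nlinarith [mul_nonneg h hαα.le]
  have h2 : (-2 : ℝ) < n := by
    by_contra! h
    nlinarith [mul_le_mul_of_nonneg_right h hαα.le]
  have h1' : n < 0 := by exact_mod_cast h1
  have h2' : -2 < n := by exact_mod_cast h2
  obtain rfl : n = -1 := by omega
  rw [hn]
  norm_num

end Roots

end Folding

open Folding

theorem nonreduced_of_nbr_card_one
    {E : Type*} [NormedAddCommGroup E] [InnerProductSpace ℝ E] [FiniteDimensional ℝ E]
    (Φ : Set E) (Δ : Finset E) (coeff : E → E → ℝ) (htilde : E) (ω : E ≃ₗᵢ[ℝ] E)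
    (hΦrs : IsRootSystem Φ) (hΦred : IsReducedRS Φ) (hΦirr : IsIrreducibleRS Φ)
    (hΔ : IsBaseRS Φ Δ)
    (hcoeff : ∀ β ∈ Φ, β = ∑ α ∈ Δ, coeff β α • α)
    (hht : htilde ∈ Φ)
    (hhighest : ∀ β ∈ Φ, β ≠ htilde → ∑ α ∈ Δ, coeff β α < ∑ α ∈ Δ, coeff htilde α)
    (hωW : InWeylGroup Φ ω)
    (hωΔ₀ : ⇑ω '' (↑Δ ∪ {-htilde}) = ↑Δ ∪ {-htilde}) :
    ∀ α ∈ Δ, (nbrOf ω α).ncard = 1 →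
      (2 : ℝ) • avg ω α ∈ foldedRoots Φ ω ∧ ¬ IsReducedRS (foldedRoots Φ ω) := by
  classical
  intro α hα hcard
  set S : Set E := ↑Δ ∪ {-htilde} with hS
  have hSfin : S.Finite := Δ.finite_toSet.union (Set.finite_singleton _)
  have hω : IsOfFinOrder ω :=
    isOfFinOrder_of_image_eq hSfin
      (top_le_iff.1 (hΔ.2.2.1.ge.trans (Submodule.span_mono Set.subset_union_left))) hωΔ₀
  have hαΦ := hΔ.1 hα
  have hαα := hΦrs.inner_self_pos hαΦ
  have horbit : orbitOf ω α ⊆ S := orbitOf_subset hωΔ₀ (Or.inl hα)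
  obtain ⟨γ, hN⟩ := Set.ncard_eq_one.1 hcard
  obtain ⟨hγO, hγα, hγnα, hγ0⟩ : γ ∈ nbrOf ω α := by rw [hN]; rfl
  obtain ⟨hγΦ, hle⟩ : γ ∈ Φ ∧ inner ℝ α γ ≤ 0 := by
    rcases horbit hγO with h | rfl
    · exact ⟨hΔ.1 h, hΔ.inner_nonpos hΦrs hα h hγα.symm⟩
    · refine ⟨hΦrs.neg_mem hht, ?_⟩
      rw [inner_neg_right, neg_nonpos]
      exact inner_highest_nonneg hΦrs hΔ hcoeff hht hhighest hα
  obtain ⟨t, ht⟩ := id hγO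
  have hm := hΦrs.inner_coroot_eq_neg_one hαΦ hγΦ
    (by rw [← ht, LinearIsometryEquiv.inner_map_map]) hγnα (lt_of_le_of_ne hle hγ0)
  have hsum : α + γ ∈ Φ := by
    have h := hΦrs.2.2.2.1 α hαΦ γ hγΦ
    rwa [reflVec, hm, neg_one_smul, sub_neg_eq_add, add_comm] at h
  have havg : avg ω (α + γ) = (2 : ℝ) • avg ω α := by
    rw [avg_add, ← ht, avg_zpow_apply, two_smul]
  have hne : avg ω α ≠ 0 := by
    intro h0
    obtain ⟨O, hO⟩ := (hSfin.subset horbit).exists_finset_coe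
    have hmem (y : E) : y ∈ O ↔ y ∈ orbitOf ω α := by rw [← hO, Finset.mem_coe]
    have hαO : α ∈ O := (hmem α).2 ⟨0, by simp⟩
    have hzero : ∑ y ∈ O, inner ℝ α y = 0 := by
      rw [← inner_sum, sum_orbit_eq_zero hω hO h0, inner_zero_right]
    have hαnα : α ≠ -α := fun h => by
      have := congrArg (inner ℝ α) h
      rw [inner_neg_right] at this
      linarith
    have hterm (y : E) (hy : y ∈ O) : inner ℝ α y =
        (if y = α then inner ℝ α α else 0) + (if y = γ then inner ℝ α γ else 0) +
          (if y = -α then inner ℝ α (-α) else 0) := by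
      by_cases h1 : y = α
      · subst h1
        simp [hγα.symm, hαnα]
      by_cases h2 : y = γ
      · subst h2
        simp [h1, hγnα]
      by_cases h3 : y = -α
      · subst h3
        simp [h1, h2]
      simp only [h1, h2, h3, if_false, add_zero]
      by_contra h4
      have : y ∈ nbrOf ω α := ⟨(hmem y).1 hy, h1, h3, h4⟩
      rw [hN] at this
      exact h2 this
    rw [Finset.sum_congr rfl hterm, Finset.sum_add_distrib, Finset.sum_add_distrib,
      Finset.sum_ite_eq', Finset.sum_ite_eq', Finset.sum_ite_eq', if_pos hαO,
      if_pos ((hmem γ).2 hγO), inner_neg_right] at hzero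
    rw [inner_coroot, div_eq_iff hαα.ne'] at hm
    split_ifs at hzero <;> linarith
  have hmem2 : (2 : ℝ) • avg ω α ∈ foldedRoots Φ ω :=
    ⟨smul_ne_zero two_ne_zero hne, α + γ, hsum, havg⟩
  refine ⟨hmem2, fun hred => hred _ hmem2 ?_⟩
  rw [smul_smul, inv_mul_cancel₀ two_ne_zero, one_smul]
  exact ⟨hne, α, hαΦ, rfl⟩
end
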